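/- Let (V, R, 𝔤) be a symmetric holonomy system and suppose there is a real number λ ≠ 0 such that B′(x,y) = λ⟨x,y⟩ for all x, y ∈ V. Then for every x ∈ V and every orthonormal basis (eᵢ) of V: λ·Ric(x,x) = Σᵢ [ κ(R(eᵢ,x), R(eᵢ,x)) + tr(R(eᵢ,x) ∘ R(eᵢ,x)) ], where the last trace is taken over V. In particular, each summand on the right-hand side is nonpositive, and if Ric(x,x) = 0 for all x ∈ V then R(x,y) = 0 for all x, y ∈ V. -/

import Mathlib

open RealInnerProductSpace

/-- The bracket on 𝔍 = 𝔤 ⊕ V for a symmetric holonomy system: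
`[(A,x),(A′,y)] = ([A,A′] − R(x,y), A(y) − A′(x))`. -/
def brkJ {V : Type} [NormedAddCommGroup V] [InnerProductSpace ℝ V]
    (g : Submodule ℝ (V →ₗ[ℝ] V))
    (hg : ∀ A ∈ g, ∀ B ∈ g, A ∘ₗ B - B ∘ₗ A ∈ g)
    (R : V →ₗ[ℝ] V →ₗ[ℝ] (V →ₗ[ℝ] V)) (hR : ∀ x y : V, R x y ∈ g) :
    (↥g × V) → (↥g × V) → (↥g × V) :=
  fun u v =>
    (⟨u.1.1 ∘ₗ v.1.1 - v.1.1 ∘ₗ u.1.1 - R u.2 v.2,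
      sub_mem (hg _ u.1.2 _ v.1.2) (hR u.2 v.2)⟩,
     u.1.1 v.2 - v.1.1 u.2)

/-- `ad_u : 𝔍 → 𝔍`, as a linear map. -/
def adJ {V : Type} [NormedAddCommGroup V] [InnerProductSpace ℝ V]
    (g : Submodule ℝ (V →ₗ[ℝ] V))
    (hg : ∀ A ∈ g, ∀ B ∈ g, A ∘ₗ B - B ∘ₗ A ∈ g)
    (R : V →ₗ[ℝ] V →ₗ[ℝ] (V →ₗ[ℝ] V)) (hR : ∀ x y : V, R x y ∈ g)
    (u : ↥g × V) : (↥g × V) →ₗ[ℝ] (↥g × V) where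
  toFun v := brkJ g hg R hR u v
  map_add' v w := by
    refine Prod.ext (Subtype.ext ?_) ?_ <;>
      simp [brkJ, LinearMap.comp_add, LinearMap.add_comp] <;> abel
  map_smul' c v := by
    refine Prod.ext (Subtype.ext ?_) ?_ <;>
      simp [brkJ, LinearMap.comp_smul, LinearMap.smul_comp, smul_sub] <;> abel

/-- The form `B′(u,v) = tr(ad_u ∘ ad_v)` on 𝔍. -/
noncomputable def Bform {V : Type} [NormedAddCommGroup V] [InnerProductSpace ℝ V]
    (g : Submodule ℝ (V →ₗ[ℝ] V))
    (hg : ∀ A ∈ g, ∀ B ∈ g, A ∘ₗ B - B ∘ₗ A ∈ g)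
    (R : V →ₗ[ℝ] V →ₗ[ℝ] (V →ₗ[ℝ] V)) (hR : ∀ x y : V, R x y ∈ g)
    (u v : ↥g × V) : ℝ :=
  LinearMap.trace ℝ (↥g × V) (adJ g hg R hR u ∘ₗ adJ g hg R hR v)

/-- `ad` within 𝔤. -/
def adg {V : Type} [NormedAddCommGroup V] [InnerProductSpace ℝ V]
    (g : Submodule ℝ (V →ₗ[ℝ] V))
    (hg : ∀ A ∈ g, ∀ B ∈ g, A ∘ₗ B - B ∘ₗ A ∈ g)
    (A : ↥g) : ↥g →ₗ[ℝ] ↥g where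
  toFun B := ⟨A.1 ∘ₗ B.1 - B.1 ∘ₗ A.1, hg _ A.2 _ B.2⟩
  map_add' B C := by
    refine Subtype.ext ?_
    simp [LinearMap.comp_add, LinearMap.add_comp]
    abel
  map_smul' c B := by
    refine Subtype.ext ?_
    simp [LinearMap.comp_smul, LinearMap.smul_comp, smul_sub]

/-- The Killing form `κ` of the Lie algebra 𝔤. -/
noncomputable def killing {V : Type} [NormedAddCommGroup V] [InnerProductSpace ℝ V]
    (g : Submodule ℝ (V →ₗ[ℝ] V))
    (hg : ∀ A ∈ g, ∀ B ∈ g, A ∘ₗ B - B ∘ₗ A ∈ g)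
    (A B : ↥g) : ℝ :=
  LinearMap.trace ℝ ↥g (adg g hg A ∘ₗ adg g hg B)

/-- The square of a skew-adjoint endomorphism has nonpositive trace. -/
lemma trace_comp_self_of_skew {W : Type*} [NormedAddCommGroup W] [InnerProductSpace ℝ W]
    {ι : Type*} [Fintype ι] (b : OrthonormalBasis ι ℝ W)
    (T : W →ₗ[ℝ] W) (hT : ∀ x y : W, ⟪T x, y⟫ = -⟪x, T y⟫) :
    LinearMap.trace ℝ W (T ∘ₗ T) = -∑ i, ‖T (b i)‖ ^ 2 := by
  classical
  rw [LinearMap.trace_eq_sum_inner _ b, ← Finset.sum_neg_distrib]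
  refine Finset.sum_congr rfl fun i _ => ?_
  rw [← real_inner_self_eq_norm_sq, hT (b i) (T (b i)), neg_neg, LinearMap.comp_apply]

/-- A skew-adjoint endomorphism whose square has trace zero vanishes. -/
lemma eq_zero_of_skew_of_trace_comp_self_eq_zero {W : Type*} [NormedAddCommGroup W]
    [InnerProductSpace ℝ W] [FiniteDimensional ℝ W]
    (T : W →ₗ[ℝ] W) (hT : ∀ x y : W, ⟪T x, y⟫ = -⟪x, T y⟫)
    (h : LinearMap.trace ℝ W (T ∘ₗ T) = 0) : T = 0 := by
  let b := stdOrthonormalBasis ℝ W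
  rw [trace_comp_self_of_skew b T hT, neg_eq_zero,
    Finset.sum_eq_zero_iff_of_nonneg fun i _ => sq_nonneg _] at h
  refine b.toBasis.ext fun i => ?_
  simpa using h i (Finset.mem_univ i)

/-- An endomorphism that is skew-adjoint for the inner product pulled back along an injective
linear map has a square of nonpositive trace. -/
lemma trace_comp_self_nonpos_of_skew_pullback {W E : Type*} [AddCommGroup W] [Module ℝ W]
    [NormedAddCommGroup E] [InnerProductSpace ℝ E] [FiniteDimensional ℝ E]
    (φ : W →ₗ[ℝ] E) (hφ : Function.Injective φ) (T : W →ₗ[ℝ] W)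
    (hT : ∀ u w : W, ⟪φ (T u), φ w⟫ = -⟪φ u, φ (T w)⟫) :
    LinearMap.trace ℝ W (T ∘ₗ T) ≤ 0 := by
  let f := LinearEquiv.ofInjective φ hφ
  have hconj : f.conj (T ∘ₗ T) = f.conj T ∘ₗ f.conj T := LinearEquiv.conj_comp f T T
  rw [← LinearMap.trace_conj' (T ∘ₗ T) f, hconj,
    trace_comp_self_of_skew (stdOrthonormalBasis ℝ _) (f.conj T)]
  · exact neg_nonpos.mpr (Finset.sum_nonneg fun i _ => sq_nonneg _)
  · intro x y
    obtain ⟨u, rfl⟩ := f.surjective x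
    obtain ⟨w, rfl⟩ := f.surjective y
    simpa [LinearEquiv.conj_apply, f, Submodule.coe_inner] using hT u w

/-- The Hilbert–Schmidt pairing `∑ᵢ ⟪B eᵢ, C eᵢ⟫` is invariant under commutators with a
skew-adjoint endomorphism, as soon as its first argument is skew-adjoint. -/
lemma sum_inner_commutator_of_skew {V : Type*} [NormedAddCommGroup V] [InnerProductSpace ℝ V]
    {ι : Type*} [Fintype ι] (b : OrthonormalBasis ι ℝ V) (A B C : V →ₗ[ℝ] V)
    (hA : ∀ x y : V, ⟪A x, y⟫ = -⟪x, A y⟫) (hB : ∀ x y : V, ⟪B x, y⟫ = -⟪x, B y⟫) :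
    ∑ i, ⟪(A ∘ₗ B - B ∘ₗ A) (b i), C (b i)⟫ = -∑ i, ⟪B (b i), (A ∘ₗ C - C ∘ₗ A) (b i)⟫ := by
  classical
  have h := (LinearMap.trace_mul_comm ℝ A (B * C)).symm
  rw [LinearMap.trace_eq_sum_inner _ b, LinearMap.trace_eq_sum_inner _ b] at h
  rw [← Finset.sum_neg_distrib, ← sub_eq_zero, ← Finset.sum_sub_distrib]
  rw [← sub_eq_zero, ← Finset.sum_sub_distrib] at h
  rw [← h]
  refine Finset.sum_congr rfl fun i _ => ?_
  have h1 := hA (B (b i)) (C (b i))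
  have h2 := hB (A (b i)) (C (b i))
  have h3 := hA (b i) (B (C (b i)))
  have h4 := hB (b i) (C (A (b i)))
  simp only [LinearMap.sub_apply, LinearMap.comp_apply, inner_sub_left, inner_sub_right,
    Module.End.mul_apply] at *
  linarith

section HolonomySystem

variable {V : Type} [NormedAddCommGroup V] [InnerProductSpace ℝ V]
  (g : Submodule ℝ (V →ₗ[ℝ] V))
  (hg : ∀ A ∈ g, ∀ B ∈ g, A ∘ₗ B - B ∘ₗ A ∈ g)

/-- The Killing form of a Lie algebra of skew-adjoint endomorphisms is negative semidefinite. -/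
lemma killing_self_nonpos [FiniteDimensional ℝ V]
    (hskew : ∀ A ∈ g, ∀ x y : V, ⟪A x, y⟫ = -⟪x, A y⟫) (A : ↥g) :
    killing g hg A A ≤ 0 := by
  let b := stdOrthonormalBasis ℝ V
  let φ : ↥g →ₗ[ℝ] PiLp 2 (fun _ : Fin (Module.finrank ℝ V) => V) :=
    (WithLp.linearEquiv 2 ℝ (Fin (Module.finrank ℝ V) → V)).symm.toLinearMap ∘ₗ
      LinearMap.pi fun i => LinearMap.applyₗ (b i) ∘ₗ g.subtype
  have hφ : ∀ B i, φ B i = B.1 (b i) := fun B i => rfl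
  refine trace_comp_self_nonpos_of_skew_pullback φ (fun B C h => ?_) _ fun B C => ?_
  · refine Subtype.ext (b.toBasis.ext fun i => ?_)
    simpa [hφ] using congrArg (fun v => v i) h
  · simpa only [PiLp.inner_apply, hφ] using! sum_inner_commutator_of_skew b A.1 B.1 C.1
      (hskew _ A.2) (hskew _ B.2)

variable (R : V →ₗ[ℝ] V →ₗ[ℝ] (V →ₗ[ℝ] V)) (hR : ∀ x y : V, R x y ∈ g)

/-- On `𝔤`, the form `B′` is the Killing form plus the trace form of `V`. -/
lemma Bform_inl_inl [FiniteDimensional ℝ V] (A A' : ↥g) :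
    Bform g hg R hR (A, 0) (A', 0)
      = killing g hg A A' + LinearMap.trace ℝ V (A.1 ∘ₗ A'.1) := by
  have h : adJ g hg R hR (A, 0) ∘ₗ adJ g hg R hR (A', 0)
      = (adg g hg A ∘ₗ adg g hg A').prodMap (A.1 ∘ₗ A'.1) := by
    refine LinearMap.ext fun v => Prod.ext (Subtype.ext ?_) ?_ <;>
      simp [adJ, brkJ, adg]
  rw [Bform, h, LinearMap.trace_prodMap', killing]

/-- The Jacobi identity on `𝔍` for two vectors, whose bracket is `-R(x,y)`. -/
lemma adJ_curvature (hRalt : ∀ x : V, R x x = 0)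
    (hB1 : ∀ x y z : V, R x y z + R y z x + R z x y = 0)
    (hS1 : ∀ A ∈ g, ∀ x y : V, A ∘ₗ R x y - R x y ∘ₗ A = R (A x) y + R x (A y)) (x y : V) :
    adJ g hg R hR (⟨R x y, hR x y⟩, 0)
      = adJ g hg R hR (0, y) ∘ₗ adJ g hg R hR (0, x)
        - adJ g hg R hR (0, x) ∘ₗ adJ g hg R hR (0, y) := by
  have hanti : ∀ u v : V, R u v = -R v u := fun u v => by
    have h := hRalt (u + v)
    simp only [map_add, LinearMap.add_apply, hRalt, zero_add, add_zero] at h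
    exact eq_neg_of_add_eq_zero_right h
  refine LinearMap.ext fun v => Prod.ext (Subtype.ext ?_) ?_
  · have h := hS1 v.1.1 v.1.2 x y
    rw [hanti (v.1.1 x) y, neg_add_eq_sub] at h
    simp [adJ, brkJ]
    rw [← neg_sub, h, neg_sub]
  · have h := hB1 x y v.2
    rw [hanti v.2 x] at h
    simp [adJ, brkJ] at h ⊢
    rw [← sub_eq_zero, ← h]
    abel

/-- The Jacobi identity on `𝔍` for an element of `𝔤` and a vector. -/
lemma adJ_apply_vector
    (hS1 : ∀ A ∈ g, ∀ x y : V, A ∘ₗ R x y - R x y ∘ₗ A = R (A x) y + R x (A y))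
    (A : ↥g) (y : V) :
    adJ g hg R hR (0, A.1 y)
      = adJ g hg R hR (A, 0) ∘ₗ adJ g hg R hR (0, y)
        - adJ g hg R hR (0, y) ∘ₗ adJ g hg R hR (A, 0) := by
  refine LinearMap.ext fun v => Prod.ext (Subtype.ext ?_) ?_
  · have h := hS1 A.1 A.2 y v.2
    simp [adJ, brkJ]
    rw [← sub_eq_iff_eq_add.mpr h]
    abel
  · simp [adJ, brkJ]
    abel

/-- Invariance of `B′`, with the bracket of two vectors written through the curvature. -/
lemma Bform_curvature (hRalt : ∀ x : V, R x x = 0)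
    (hB1 : ∀ x y z : V, R x y z + R y z x + R z x y = 0)
    (hS1 : ∀ A ∈ g, ∀ x y : V, A ∘ₗ R x y - R x y ∘ₗ A = R (A x) y + R x (A y))
    (x y : V) (A : ↥g) :
    Bform g hg R hR (⟨R x y, hR x y⟩, 0) (A, 0) = Bform g hg R hR (0, x) (0, A.1 y) := by
  rw [Bform, Bform, adJ_curvature g hg R hR hRalt hB1 hS1, adJ_apply_vector g hg R hR hS1,
    LinearMap.sub_comp, LinearMap.comp_sub]
  refine (map_sub (LinearMap.trace ℝ (↥g × V)) _ _).trans
    (Eq.trans ?_ (map_sub (LinearMap.trace ℝ (↥g × V)) _ _).symm)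
  have h := LinearMap.trace_mul_comm ℝ (adJ g hg R hR (0, y))
    (adJ g hg R hR (0, x) * adJ g hg R hR (A, 0))
  simp only [Module.End.mul_eq_comp, LinearMap.comp_assoc] at h ⊢
  rw [h]

end HolonomySystem

/-- For a symmetric holonomy system with `B′|_V = λ⟨·,·⟩`, `λ ≠ 0`:
`λ·Ric(x,x) = Σᵢ [κ(R(eᵢ,x), R(eᵢ,x)) + tr(R(eᵢ,x) ∘ R(eᵢ,x))]` for every orthonormal
basis `(eᵢ)`; each summand is nonpositive; and Ricci flatness implies flatness. -/
theorem ricci_formula_and_flatness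
    {V : Type} [NormedAddCommGroup V] [InnerProductSpace ℝ V]
    [FiniteDimensional ℝ V] [Nontrivial V]
    (g : Submodule ℝ (V →ₗ[ℝ] V))
    (hg_lie : ∀ A ∈ g, ∀ B ∈ g, A ∘ₗ B - B ∘ₗ A ∈ g)
    (hg_skew : ∀ A ∈ g, ∀ x y : V, ⟪A x, y⟫ = -⟪x, A y⟫)
    (R : V →ₗ[ℝ] V →ₗ[ℝ] (V →ₗ[ℝ] V)) (hRg : ∀ x y : V, R x y ∈ g)
    (hRalt : ∀ x : V, R x x = 0)
    (hB1 : ∀ x y z : V, R x y z + R y z x + R z x y = 0)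
    (hS1 : ∀ A ∈ g, ∀ x y : V,
      A ∘ₗ R x y - R x y ∘ₗ A = R (A x) y + R x (A y))
    (lam : ℝ) (hlam : lam ≠ 0)
    (hBV : ∀ x y : V,
      Bform g hg_lie R hRg ((0 : ↥g), x) ((0 : ↥g), y) = lam * ⟪x, y⟫) :
    (∀ (ι : Type) (_ : Fintype ι) (e : OrthonormalBasis ι ℝ V) (x : V),
      lam * (∑ i, ⟪R (e i) x x, e i⟫)
        = ∑ i, (killing g hg_lie ⟨R (e i) x, hRg (e i) x⟩ ⟨R (e i) x, hRg (e i) x⟩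
            + LinearMap.trace ℝ V (R (e i) x ∘ₗ R (e i) x)))
    ∧ (∀ (ι : Type) (_ : Fintype ι) (e : OrthonormalBasis ι ℝ V) (x : V) (i : ι),
        killing g hg_lie ⟨R (e i) x, hRg (e i) x⟩ ⟨R (e i) x, hRg (e i) x⟩
          + LinearMap.trace ℝ V (R (e i) x ∘ₗ R (e i) x) ≤ 0)
    ∧ ((∀ (ι : Type) (_ : Fintype ι) (e : OrthonormalBasis ι ℝ V) (x : V),
          ∑ i, ⟪R (e i) x x, e i⟫ = 0) → ∀ x y : V, R x y = 0) := by
  have key : ∀ x y : V, killing g hg_lie ⟨R x y, hRg x y⟩ ⟨R x y, hRg x y⟩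
      + LinearMap.trace ℝ V (R x y ∘ₗ R x y) = lam * ⟪R x y y, x⟫ := fun x y => by
    rw [← Bform_inl_inl g hg_lie R hRg ⟨R x y, hRg x y⟩ ⟨R x y, hRg x y⟩,
      Bform_curvature g hg_lie R hRg hRalt hB1 hS1, hBV, real_inner_comm]
  have hκ : ∀ A : ↥g, killing g hg_lie A A ≤ 0 := killing_self_nonpos g hg_lie hg_skew
  have htr : ∀ x y : V, LinearMap.trace ℝ V (R x y ∘ₗ R x y) ≤ 0 := fun x y =>
    trace_comp_self_nonpos_of_skew_pullback LinearMap.id Function.injective_id _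
      (hg_skew _ (hRg x y))
  refine ⟨fun ι _ e x => ?_, fun ι _ e x i => add_nonpos (hκ _) (htr _ _), fun hRic => ?_⟩
  · rw [Finset.mul_sum]
    exact Finset.sum_congr rfl fun i _ => (key (e i) x).symm
  · let e := stdOrthonormalBasis ℝ V
    suffices h : ∀ y, R.flip y = 0 from fun x y => LinearMap.congr_fun (h y) x
    refine fun y => e.toBasis.ext fun i => ?_
    have hsum := congrArg (lam * ·) (hRic _ _ e y)
    simp only [Finset.mul_sum, mul_zero, ← key] at hsum
    rw [Finset.sum_eq_zero_iff_of_nonpos fun i _ => add_nonpos (hκ _) (htr _ _)] at hsum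
    have hi := hsum i (Finset.mem_univ i)
    have htr0 : LinearMap.trace ℝ V (R (e i) y ∘ₗ R (e i) y) = 0 :=
      le_antisymm (htr _ _) (by linarith [hκ ⟨R (e i) y, hRg (e i) y⟩])
    simpa using eq_zero_of_skew_of_trace_comp_self_eq_zero _ (hg_skew _ (hRg _ _)) htr0
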